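/- Let u ≥ v ≥ 1 be integers, n ≥ 1, and let w = (w_1, …, w_n) ∈ {0,1}^n be a word with w_n = 0 (so that the rightmost factor of M_{u,v}(w) is L_u, i.e., M_{u,v}(w) lies in the subtree of the (u,v)-Calkin–Wilf tree below L_u). Then μ(M_{u,v}(w̄)) ≤ μ(M_{u,v}(w)), where w̄ is the bitwise complement of w and μ(M) denotes the maximum of the four entries of M. -/

import Mathlib

open Matrix Finset

def Lm (u : ℕ) : Matrix (Fin 2) (Fin 2) ℕ := !![1, 0; u, 1]
def Rm (v : ℕ) : Matrix (Fin 2) (Fin 2) ℕ := !![1, v; 0, 1]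

/-- The product of the matrices corresponding to a word: `false ↦ L_u`, `true ↦ R_v`. -/
def wordProd (u v : ℕ) (w : List Bool) : Matrix (Fin 2) (Fin 2) ℕ :=
  (w.map (fun b => if b then Rm v else Lm u)).prod

/-- μ of a matrix: maximum of the four entries. -/
def matMax (M : Matrix (Fin 2) (Fin 2) ℕ) : ℕ :=
  max (max (M 0 0) (M 0 1)) (max (M 1 0) (M 1 1))

/-- μ(𝒯^{(u,v)}(I₂;n)): maximum of μ over all products of exactly n matrices each L_u or R_v. -/
def levelMax (u v n : ℕ) : ℕ :=
  Finset.univ.sup (fun w : Fin n → Bool => matMax (wordProd u v (List.ofFn w)))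


lemma wordProd_form (u v : ℕ) (w : List Bool) : ∃ a b c d : ℕ,
    wordProd u v w = !![a, v * b; u * c, d] ∧
    wordProd u v (w.map (fun x => !x)) = !![d, v * c; u * b, a] := by
  induction w using List.reverseRecOn with
  | nil =>
    refine ⟨1, 0, 0, 1, ?_, ?_⟩ <;> simp [wordProd, Matrix.one_fin_two]
  | append_singleton l x ih =>
    obtain ⟨a, b, c, d, h1, h2⟩ := ih
    have e1 : ∀ (l : List Bool) (y : Bool), wordProd u v (l ++ [y]) =
        wordProd u v l * (if y then Rm v else Lm u) := by
      intro l y; simp [wordProd]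
    rw [List.map_append, List.map_singleton, e1, e1, h1, h2]
    cases x
    · refine ⟨a + u * v * b, b, c + d, d, ?_, ?_⟩ <;>
        simp [Lm, Rm, Matrix.mul_fin_two] <;> ring_nf <;> simp
    · refine ⟨a, a + b, c, d + u * v * c, ?_, ?_⟩ <;>
        simp [Lm, Rm, Matrix.mul_fin_two] <;> ring_nf <;> simp

theorem stmt18 (u v : ℕ) (hv : 1 ≤ v) (huv : v ≤ u) (n : ℕ) (hn : 1 ≤ n)
    (w : List Bool) (hw : w.length = n) (hlast : w.getLast? = some false) :
    matMax (wordProd u v (w.map (fun x => !x))) ≤ matMax (wordProd u v w) := by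
  obtain ⟨l, rfl⟩ := List.getLast?_eq_some_iff.mp hlast
  obtain ⟨a, b, c, d, h1, h2⟩ := wordProd_form u v l
  have e1 : wordProd u v (l ++ [false]) = wordProd u v l * Lm u := by
    simp [wordProd]
  have e2 : wordProd u v ((l ++ [false]).map (fun x => !x)) =
      wordProd u v (l.map (fun x => !x)) * Rm v := by
    simp [wordProd]
  rw [e1, e2, h1, h2]
  have k1 : v * d + v * c ≤ u * c + d * u := by nlinarith [Nat.mul_le_mul_right (c + d) huv]
  have k2 : u * b ≤ a + v * b * u := by nlinarith [Nat.mul_le_mul_right (u * b) hv]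
  have k3 : u * b * v + a = a + v * b * u := by ring
  simp only [matMax, Lm, Rm, Matrix.mul_fin_two, Matrix.of_apply, Matrix.cons_val', Matrix.cons_val_zero,
    Matrix.cons_val_one, Matrix.cons_val_fin_one, mul_one, mul_zero, zero_add, add_zero]
  generalize v * b * u = p at *
  generalize u * b * v = q at *
  rw [mul_comm d v]
  omega
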